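/- Let n ≥ 2, let x ∈ 𝔹ⁿ and 0 < r < r₀ where r₀ = (1−|x|)/√(2(1+|x|²)). Set a = 1 − r²(1+|x|²), m = 2·arcsinh[ r(√(1−r²) − r|x|)(1+|x|²) / (√(1−|x|²)·a·√(1 − a^{−2}(|x| − r√(1−r²)(1+|x|²))²)) ], and M = 2·arcsinh[ r(√(1−r²) + r|x|)(1+|x|²) / (√(1−|x|²)·a·√(1 − a^{−2}(|x| + r√(1−r²)(1+|x|²))²)) ]. Then B_ρ(x, m) ⊂ B_q(x, r) and B_q(x, r) ⊂ B_ρ(x, M). -/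

import Mathlib

open Real Set

/-- The distance ratio metric (j-metric) on the unit ball of ℝⁿ:
`j(x,y) = log(1 + |x−y| / min(1−|x|, 1−|y|))`. -/
noncomputable def jdist {n : ℕ} (x y : EuclideanSpace ℝ (Fin n)) : ℝ :=
  Real.log (1 + ‖x - y‖ / min (1 - ‖x‖) (1 - ‖y‖))

/-- The hyperbolic metric of the unit ball of ℝⁿ:
`ρ(x,y) = 2·arcsinh(|x−y| / (√(1−|x|²)·√(1−|y|²)))`. -/
noncomputable def rhodist {n : ℕ} (x y : EuclideanSpace ℝ (Fin n)) : ℝ :=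
  2 * Real.arsinh (‖x - y‖ / (Real.sqrt (1 - ‖x‖ ^ 2) * Real.sqrt (1 - ‖y‖ ^ 2)))

/-- The chordal metric on ℝⁿ: `q(x,y) = |x−y| / (√(1+|x|²)·√(1+|y|²))`. -/
noncomputable def qdist {n : ℕ} (x y : EuclideanSpace ℝ (Fin n)) : ℝ :=
  ‖x - y‖ / (Real.sqrt (1 + ‖x‖ ^ 2) * Real.sqrt (1 + ‖y‖ ^ 2))

/-- The quasihyperbolic metric of the unit ball of ℝⁿ: the infimum over piecewise C¹
paths `γ : [0,1] → 𝔹ⁿ` from `x` to `y` of `∫₀¹ ‖γ′(t)‖ / (1 − ‖γ(t)‖) dt`. -/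
noncomputable def kdist {n : ℕ} (x y : EuclideanSpace ℝ (Fin n)) : ℝ :=
  sInf { L : ℝ | ∃ γ : ℝ → EuclideanSpace ℝ (Fin n),
    γ 0 = x ∧ γ 1 = y ∧ ContinuousOn γ (Set.Icc 0 1) ∧
    (∀ t ∈ Set.Icc (0:ℝ) 1, ‖γ t‖ < 1) ∧
    (∃ s : Finset ℝ, ∀ t ∈ Set.Icc (0:ℝ) 1 \ (s : Set ℝ), DifferentiableAt ℝ γ t) ∧
    L = ∫ t in (0:ℝ)..1, ‖deriv γ t‖ / (1 - ‖γ t‖) }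

/-- For `0 ≤ s < 1`, the quotient `|s - v| / √(1 - v²)` decreases in `v ∈ [0, s]`. -/
theorem sq_sub_mul_one_sub_sq_le {s t u : ℝ} (ht : 0 ≤ t) (htu : t ≤ u) (hus : u ≤ s)
    (hs : s < 1) : (s - u) ^ 2 * (1 - t ^ 2) ≤ (s - t) ^ 2 * (1 - u ^ 2) := by
  have h1 : 0 ≤ (s - t) * (1 - s * u) := mul_nonneg (by linarith) (by nlinarith)
  have h2 : 0 ≤ (s - u) * (1 - s * t) := mul_nonneg (by linarith) (by nlinarith)
  linear_combination mul_nonneg (sub_nonneg.2 htu) (add_nonneg h1 h2)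

/-- A point of the chordal ball `(s - t)² ≤ d² < c (1 + t²)` is hyperbolically closer than the
far intersection point `p` of the chordal sphere with the axis. -/
theorem chordal_ball_hyperbolic_upper {s t d a c p q : ℝ} (hc : 0 < c) (ha : 0 < a)
    (ht : 0 ≤ t) (hqp : q ≤ p) (hp1 : p < 1) (hd : (s - t) ^ 2 ≤ d ^ 2)
    (key : ∀ v, (s - v) ^ 2 - c * (1 + v ^ 2) = a * ((v - p) * (v - q)))
    (h : d ^ 2 < c * (1 + t ^ 2)) :
    t < 1 ∧ d ^ 2 * (1 - p ^ 2) < (s - p) ^ 2 * (1 - t ^ 2) := by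
  have htp : t < p := by
    by_contra! hpt
    have h1 : 0 ≤ a * ((t - p) * (t - q)) :=
      mul_nonneg ha.le (mul_nonneg (by linarith) (by linarith))
    linarith [key t]
  refine ⟨htp.trans hp1, ?_⟩
  have hp2 : 0 < 1 - p ^ 2 := by nlinarith
  have hsp : (s - p) ^ 2 = c * (1 + p ^ 2) := by linear_combination key p
  rw [hsp]
  have h1 : t ^ 2 ≤ p ^ 2 := pow_le_pow_left₀ ht htp.le 2
  linear_combination mul_lt_mul_of_pos_right h hp2 + 2 * mul_le_mul_of_nonneg_left h1 hc.le

/-- A point outside the chordal ball is hyperbolically at least as far as the near intersection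
point `q` of the chordal sphere with the axis. -/
theorem chordal_ball_hyperbolic_lower {s t d a c p q : ℝ} (hc : 0 < c) (ha : 0 < a)
    (hs1 : s < 1) (ht : 0 ≤ t) (hq1 : -1 < q) (hqp : -q ≤ p) (hqs : q ≤ s)
    (hd : (s - t) ^ 2 ≤ d ^ 2) (hd' : d ^ 2 ≤ (s + t) ^ 2)
    (key : ∀ v, (s - v) ^ 2 - c * (1 + v ^ 2) = a * ((v - p) * (v - q)))
    (h : c * (1 + t ^ 2) ≤ d ^ 2) :
    (s - q) ^ 2 * (1 - t ^ 2) ≤ d ^ 2 * (1 - q ^ 2) := by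
  have hq2 : 0 ≤ 1 - q ^ 2 := by nlinarith
  have hsq : (s - q) ^ 2 = c * (1 + q ^ 2) := by linear_combination key q
  rcases le_or_gt (|q|) t with hqt | hqt
  · have h1 : q ^ 2 ≤ t ^ 2 := sq_le_sq' (by linarith [neg_abs_le q]) (by linarith [le_abs_self q])
    rw [hsq]
    linear_combination mul_le_mul_of_nonneg_right h hq2 + 2 * mul_le_mul_of_nonneg_left h1 hc.le
  rcases le_or_gt 0 q with hq0 | hq0
  · rw [abs_of_nonneg hq0] at hqt
    exact (sq_sub_mul_one_sub_sq_le ht hqt.le hqs hs1).trans (mul_le_mul_of_nonneg_right hd hq2)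
  · rw [abs_of_neg hq0] at hqt
    have h1 : 0 < a * ((t + p) * (-q - t)) :=
      mul_pos ha (mul_pos (by linarith) (by linarith))
    have := key (-t)
    nlinarith

/-- The far endpoint `(s + r √(1 - r²) (1 + s²)) / a` stays inside the unit interval when
`r < r₀`. -/
theorem chordal_ball_endpoint_lt {s r w : ℝ} (hs : 0 ≤ s) (hs1 : s < 1)
    (hw2 : w ^ 2 = 1 - r ^ 2) (hr : 2 * (r ^ 2 * (1 + s ^ 2)) < (1 - s) ^ 2) :
    s + r * w * (1 + s ^ 2) < 1 - r ^ 2 * (1 + s ^ 2) := by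
  have h1 : 0 < 1 - s - r ^ 2 * (1 + s ^ 2) := by nlinarith
  have h2 : (r * w * (1 + s ^ 2)) ^ 2 < (1 - s - r ^ 2 * (1 + s ^ 2)) ^ 2 := by
    have h3 : 0 < ((1 - s) ^ 2 - 2 * (r ^ 2 * (1 + s ^ 2))) * (1 - r ^ 2 * (1 + s ^ 2)) :=
      mul_pos (by linarith) (by linarith)
    have h4 : (r * w * (1 + s ^ 2)) ^ 2 = r ^ 2 * (1 - r ^ 2) * (1 + s ^ 2) ^ 2 := by
      rw [← hw2]; ring
    rw [h4]
    linear_combination h3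
  linarith [lt_of_pow_lt_pow_left₀ 2 h1.le h2]

theorem qdist_lt_iff {n : ℕ} (x y : EuclideanSpace ℝ (Fin n)) {r : ℝ} (hr : 0 < r) :
    qdist x y < r ↔ ‖x - y‖ ^ 2 < r ^ 2 * (1 + ‖x‖ ^ 2) * (1 + ‖y‖ ^ 2) := by
  have hx : 0 < 1 + ‖x‖ ^ 2 := by positivity
  have hy : 0 < 1 + ‖y‖ ^ 2 := by positivity
  rw [qdist, div_lt_iff₀ (by positivity), ← sq_lt_sq₀ (by positivity) (by positivity), mul_pow,
    mul_pow, Real.sq_sqrt hx.le, Real.sq_sqrt hy.le, mul_assoc]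

/-- Comparison of `rhodist` with the value `2 arsinh (b / (√(1 - |x|²) a √(1 - U² / a²)))`. -/
theorem rhodist_lt_iff {n : ℕ} {x y : EuclideanSpace ℝ (Fin n)} (hx : ‖x‖ < 1) (hy : ‖y‖ < 1)
    {a b U : ℝ} (ha : 0 < a) (hb : 0 ≤ b) (hU : 0 < 1 - (U / a) ^ 2) :
    rhodist x y < 2 * Real.arsinh (b / (Real.sqrt (1 - ‖x‖ ^ 2) * a *
        Real.sqrt (1 - U ^ 2 / a ^ 2))) ↔
      ‖x - y‖ ^ 2 * (1 - (U / a) ^ 2) < (b / a) ^ 2 * (1 - ‖y‖ ^ 2) := by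
  have hx2 : 0 < 1 - ‖x‖ ^ 2 := by nlinarith [norm_nonneg x]
  have hy2 : 0 < 1 - ‖y‖ ^ 2 := by nlinarith [norm_nonneg y]
  have hX := Real.sqrt_pos.2 hx2
  have hY := Real.sqrt_pos.2 hy2
  have hV := Real.sqrt_pos.2 hU
  have e1 : b / (Real.sqrt (1 - ‖x‖ ^ 2) * a * Real.sqrt (1 - U ^ 2 / a ^ 2)) =
      b / a / Real.sqrt (1 - (U / a) ^ 2) / Real.sqrt (1 - ‖x‖ ^ 2) := by
    rw [← div_pow, div_div, div_div]
    congr 1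
    ring
  have e2 : ‖x - y‖ / (Real.sqrt (1 - ‖x‖ ^ 2) * Real.sqrt (1 - ‖y‖ ^ 2)) =
      ‖x - y‖ / Real.sqrt (1 - ‖y‖ ^ 2) / Real.sqrt (1 - ‖x‖ ^ 2) := by
    rw [div_div, mul_comm]
  rw [rhodist, mul_lt_mul_iff_right₀ two_pos, Real.arsinh_lt_arsinh, e1, e2,
    div_lt_div_iff_of_pos_right hX, div_lt_div_iff₀ hY hV,
    ← sq_lt_sq₀ (by positivity) (by positivity), mul_pow, mul_pow, Real.sq_sqrt hU.le,
    Real.sq_sqrt hy2.le]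

/-- For `x ∈ 𝔹ⁿ` and `0 < r < r₀ = (1−|x|)/√(2(1+|x|²))`, with
`a = 1 − r²(1+|x|²)`,
`m = 2·arcsinh[r(√(1−r²)−r|x|)(1+|x|²)/(√(1−|x|²)·a·√(1−a⁻²(|x|−r√(1−r²)(1+|x|²))²))]`,
`M = 2·arcsinh[r(√(1−r²)+r|x|)(1+|x|²)/(√(1−|x|²)·a·√(1−a⁻²(|x|+r√(1−r²)(1+|x|²))²))]`,
one has `B_ρ(x,m) ⊂ B_q(x,r)` and `B_q(x,r) ⊂ B_ρ(x,M)`. -/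
theorem stmt_16 {n : ℕ} (hn : 2 ≤ n) (x : EuclideanSpace ℝ (Fin n)) (hx : ‖x‖ < 1)
    (r : ℝ) (hr : 0 < r) (hr0 : r < (1 - ‖x‖) / Real.sqrt (2 * (1 + ‖x‖ ^ 2))) :
    let a : ℝ := 1 - r ^ 2 * (1 + ‖x‖ ^ 2)
    let m : ℝ := 2 * Real.arsinh (r * (Real.sqrt (1 - r ^ 2) - r * ‖x‖) * (1 + ‖x‖ ^ 2) /
      (Real.sqrt (1 - ‖x‖ ^ 2) * a *
        Real.sqrt (1 - (‖x‖ - r * Real.sqrt (1 - r ^ 2) * (1 + ‖x‖ ^ 2)) ^ 2 / a ^ 2)))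
    let M : ℝ := 2 * Real.arsinh (r * (Real.sqrt (1 - r ^ 2) + r * ‖x‖) * (1 + ‖x‖ ^ 2) /
      (Real.sqrt (1 - ‖x‖ ^ 2) * a *
        Real.sqrt (1 - (‖x‖ + r * Real.sqrt (1 - r ^ 2) * (1 + ‖x‖ ^ 2)) ^ 2 / a ^ 2)))
    (∀ y : EuclideanSpace ℝ (Fin n), ‖y‖ < 1 → rhodist x y < m → qdist x y < r) ∧
    (∀ y : EuclideanSpace ℝ (Fin n), qdist x y < r → ‖y‖ < 1 ∧ rhodist x y < M) := by
  intro a m M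
  set s := ‖x‖ with hs_def
  have hs : 0 ≤ s := norm_nonneg x
  have hk : 0 < 1 + s ^ 2 := by positivity
  have hr2 : 2 * (r ^ 2 * (1 + s ^ 2)) < (1 - s) ^ 2 := by
    rw [lt_div_iff₀ (by positivity)] at hr0
    have := pow_lt_pow_left₀ hr0 (by positivity) two_ne_zero
    rw [mul_pow, Real.sq_sqrt (by positivity)] at this
    linarith
  have hz : r ^ 2 * (1 + s ^ 2) < 1 := by nlinarith
  have ha : 0 < a := sub_pos.2 hz
  have hr1 : 0 ≤ 1 - r ^ 2 := by nlinarith [mul_nonneg (sq_nonneg r) (sq_nonneg s)]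
  set w := Real.sqrt (1 - r ^ 2) with hw_def
  have hw : 0 ≤ w := Real.sqrt_nonneg _
  have hw2 : w ^ 2 = 1 - r ^ 2 := Real.sq_sqrt hr1
  have hrs : r * s ≤ w := Real.le_sqrt_of_sq_le (by linarith [mul_pow r s 2])
  have hrwk : 0 ≤ r * w * (1 + s ^ 2) := by positivity
  have hend : s + r * w * (1 + s ^ 2) < a := chordal_ball_endpoint_lt hs hx hw2 hr2
  obtain ⟨p, hp⟩ : ∃ p, p = (s + r * w * (1 + s ^ 2)) / a := ⟨_, rfl⟩
  obtain ⟨q, hq⟩ : ∃ q, q = (s - r * w * (1 + s ^ 2)) / a := ⟨_, rfl⟩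
  have hp0 : 0 ≤ p := hp ▸ div_nonneg (by linarith) ha.le
  have hp1 : p < 1 := by rw [hp, div_lt_one ha]; exact hend
  have hqp : q ≤ p := by rw [hp, hq]; gcongr; linarith
  have hqp' : -q ≤ p := by rw [hp, hq, ← neg_div]; gcongr; linarith
  have hps : (r * (w + r * s) * (1 + s ^ 2) / a) = p - s := by
    rw [hp, div_eq_iff ha.ne', sub_mul, div_mul_cancel₀ _ ha.ne']
    simp only [a]
    ring
  have hqs : (r * (w - r * s) * (1 + s ^ 2) / a) = s - q := by
    rw [hq, div_eq_iff ha.ne', sub_mul, div_mul_cancel₀ _ ha.ne']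
    simp only [a]
    ring
  have hb : 0 ≤ r * (w - r * s) * (1 + s ^ 2) := by
    have := sub_nonneg.2 hrs
    positivity
  have hqs' : q ≤ s := by
    rw [← sub_nonneg, ← hqs]
    exact div_nonneg hb ha.le
  have key : ∀ v, (s - v) ^ 2 - r ^ 2 * (1 + s ^ 2) * (1 + v ^ 2) = a * ((v - p) * (v - q)) := by
    intro v
    have hap : a * p = s + r * w * (1 + s ^ 2) := by rw [hp, mul_div_cancel₀ _ ha.ne']
    have haq : a * q = s - r * w * (1 + s ^ 2) := by rw [hq, mul_div_cancel₀ _ ha.ne']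
    have ha_eq : a = 1 - r ^ 2 * (1 + s ^ 2) := rfl
    apply mul_left_cancel₀ ha.ne'
    calc a * ((s - v) ^ 2 - r ^ 2 * (1 + s ^ 2) * (1 + v ^ 2))
        = (a * v - (s + r * w * (1 + s ^ 2))) * (a * v - (s - r * w * (1 + s ^ 2))) := by
          rw [ha_eq]
          linear_combination r ^ 2 * (1 + s ^ 2) ^ 2 * hw2
      _ = a * (a * ((v - p) * (v - q))) := by rw [← hap, ← haq]; ring
  have hc : 0 < r ^ 2 * (1 + s ^ 2) := by positivity
  have hp2 : 0 < 1 - p ^ 2 := by nlinarith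
  have hq2 : 0 < 1 - q ^ 2 := by nlinarith
  have hd (y : EuclideanSpace ℝ (Fin n)) : (s - ‖y‖) ^ 2 ≤ ‖x - y‖ ^ 2 :=
    sq_le_sq.2 ((abs_norm_sub_norm_le x y).trans (le_abs_self _))
  have hd' (y : EuclideanSpace ℝ (Fin n)) : ‖x - y‖ ^ 2 ≤ (s + ‖y‖) ^ 2 :=
    pow_le_pow_left₀ (norm_nonneg _) (norm_sub_le x y) 2
  refine ⟨fun y hy hρ => ?_, fun y hy => ?_⟩
  · rw [rhodist_lt_iff hx hy ha hb (by rwa [← hq]), ← hq, hqs] at hρ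
    rw [qdist_lt_iff x y hr]
    by_contra! h
    exact absurd hρ (not_lt.2 (chordal_ball_hyperbolic_lower hc ha hx (norm_nonneg y)
      (by linarith) hqp' hqs' (hd y) (hd' y) key h))
  · rw [qdist_lt_iff x y hr] at hy
    obtain ⟨hy1, h⟩ := chordal_ball_hyperbolic_upper hc ha (norm_nonneg y) hqp hp1 (hd y) key hy
    refine ⟨hy1, ?_⟩
    rw [rhodist_lt_iff hx hy1 ha (by positivity) (by rwa [← hp]), ← hp, hps]
    linear_combination h
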